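/- arXiv:1109.0699 — 2 statements merged into one kernel-verified Lean document; each statement's English description precedes it below -/
import Mathlib

section
/- M_L and I_L with the logical topologies form a topological groupoid: the identity map e : M_L → I_L, M ↦ (M,M,id_M); the inversion map i : I_L → I_L, (M,N,f) ↦ (N,M,f⁻¹); and the composition map m : I_L ×_{M_L} I_L → I_L, defined on pairs ((M,N,f),(N,K,g)) with matching middle structure by ((M,N,f),(N,K,g)) ↦ (M,K,g∘f), where the fiber product carries the subspace topology of the product, are all continuous (d and c are continuous by definition). -/
open FirstOrder Language Set Topology TopologicalSpace Cardinal

universe u v w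

namespace SemGpd

variable (L : FirstOrder.Language.{u, v}) (S : Type w)

/-- An `S`-indexed `L`-structure: a subset `A ⊆ S`, an equivalence relation `≈` on `A`,
and an `L`-structure on the quotient `A/≈`. -/
structure IndexedStructure where
  A : Set S
  r : Setoid A
  str : L.Structure (Quotient r)

variable {L S}

/-- The underlying set (carrier) `A/≈` of an indexed structure. -/
abbrev IndexedStructure.carrier (M : IndexedStructure L S) : Type w := Quotient M.r

/-- The equivalence class of an indexed element. -/
def IndexedStructure.cls (M : IndexedStructure L S) (a : S) (h : a ∈ M.A) : M.carrier :=
  Quotient.mk M.r ⟨a, h⟩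

/-- Satisfaction of a formula in an indexed structure under an assignment. -/
def IndexedStructure.Sat (M : IndexedStructure L S) {α : Type*} (φ : L.Formula α)
    (v : α → M.carrier) : Prop :=
  letI := M.str
  φ.Realize v

/-- Satisfaction of a sentence in an indexed structure. -/
def IndexedStructure.SatSentence (M : IndexedStructure L S) (σ : L.Sentence) : Prop :=
  letI := M.str
  M.carrier ⊨ σ

/-- `M` is an `S`-indexed model of the theory `T`. -/
def IndexedStructure.models (M : IndexedStructure L S) (T : Set L.Sentence) : Prop :=
  ∀ σ ∈ T, M.SatSentence σ

variable (L S)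

/-- The basic set `⟨φ, a⟩` of indexed structures. -/
def fSet {n : ℕ} (φ : L.Formula (Fin n)) (a : Fin n → S) : Set (IndexedStructure L S) :=
  {M | ∃ h : ∀ i, a i ∈ M.A, M.Sat φ fun i => M.cls (a i) (h i)}

/-- The basic set `⟨a⟩` of structures in which `a` is indexed. -/
def membSet (a : S) : Set (IndexedStructure L S) :=
  {M | a ∈ M.A}

/-- The logical topology on the space of `S`-indexed `L`-structures, generated by the
membership conditions `⟨a⟩` and the atomic conditions `⟨φ, a⟩` for `φ` atomic (which include
the relation conditions `⟨R,a⟩`, the function conditions `⟨f(a)=b⟩` and equality conditions). -/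
def logicalTopology : TopologicalSpace (IndexedStructure L S) :=
  generateFrom {U | (∃ a : S, U = membSet L S a) ∨
    ∃ (n : ℕ) (φ : L.Formula (Fin n)), BoundedFormula.IsAtomic φ ∧
      ∃ a : Fin n → S, U = fSet L S φ a}

instance : TopologicalSpace (IndexedStructure L S) := logicalTopology L S

/-- An isomorphism between `S`-indexed `L`-structures. -/
structure IndexedIso where
  dom : IndexedStructure L S
  cod : IndexedStructure L S
  iso : @Language.Equiv L dom.carrier cod.carrier dom.str cod.str

variable {L S}

/-- Application of an isomorphism of indexed structures to an element of the domain. -/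
def IndexedIso.map (F : IndexedIso L S) (x : F.dom.carrier) : F.cod.carrier :=
  (@Language.Equiv.toEquiv L F.dom.carrier F.cod.carrier F.dom.str F.cod.str F.iso) x

/-- The basic set `⟨a ↦ b⟩` of isomorphisms. -/
def mapSet (a b : S) : Set (IndexedIso L S) :=
  {F | ∃ (ha : a ∈ F.dom.A) (hb : b ∈ F.cod.A),
    F.map (F.dom.cls a ha) = F.cod.cls b hb}

variable (L S)

/-- The logical topology on the space of isomorphisms of `S`-indexed `L`-structures:
the coarsest topology making `dom` and `cod` continuous and containing each `⟨a ↦ b⟩`. -/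
def isoTopology : TopologicalSpace (IndexedIso L S) :=
  ((logicalTopology L S).induced IndexedIso.dom) ⊓
    ((logicalTopology L S).induced IndexedIso.cod) ⊓
    generateFrom {V | ∃ a b : S, V = mapSet a b}

instance : TopologicalSpace (IndexedIso L S) := isoTopology L S

variable {L S}

/-- The identity isomorphism. -/
def idIso (M : IndexedStructure L S) : IndexedIso L S :=
  ⟨M, M, by letI := M.str; exact Language.Equiv.refl L M.carrier⟩

/-- The inverse of an isomorphism of indexed structures. -/
def IndexedIso.inv (F : IndexedIso L S) : IndexedIso L S :=
  ⟨F.cod, F.dom, by letI := F.dom.str; letI := F.cod.str; exact F.iso.symm⟩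

/-- The composite of two composable isomorphisms of indexed structures. -/
def IndexedIso.comp (F G : IndexedIso L S) (h : F.cod = G.dom) : IndexedIso L S :=
  ⟨F.dom, G.cod, by
    letI := F.dom.str; letI := F.cod.str; letI := G.cod.str
    exact Language.Equiv.comp (by rw [h]; exact G.iso) F.iso⟩

variable (L S)

/-- The space of composable pairs of isomorphisms, as a subspace of the product. -/
def CompPairs := {p : IndexedIso L S × IndexedIso L S // p.1.cod = p.2.dom}

instance : TopologicalSpace (CompPairs L S) :=
  instTopologicalSpaceSubtype

/-- The space `M_T` of `S`-indexed models of `T`, as a subspace of `M_L`. -/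
abbrev ModelsT (T : Set L.Sentence) := {M : IndexedStructure L S // M.models T}

/-- The space `I_T` of isomorphisms between `S`-indexed models of `T`, as a subspace of `I_L`. -/
abbrev IsoT (T : Set L.Sentence) := {F : IndexedIso L S // F.dom.models T ∧ F.cod.models T}

variable {L S}

/-- The domain map `d : I_T → M_T`. -/
def IsoT.d {T : Set L.Sentence} (F : IsoT L S T) : ModelsT L S T := ⟨F.1.dom, F.2.1⟩

/-- The codomain map `c : I_T → M_T`. -/
def IsoT.c {T : Set L.Sentence} (F : IsoT L S T) : ModelsT L S T := ⟨F.1.cod, F.2.2⟩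

/-- Horn formulas: finite conjunctions of atomic formulas (including `⊤`). -/
inductive IsHorn {α : Type*} : ∀ {n : ℕ}, L.BoundedFormula α n → Prop
  | top {n : ℕ} : IsHorn (⊤ : L.BoundedFormula α n)
  | equal {n : ℕ} (t₁ t₂ : L.Term (α ⊕ Fin n)) : IsHorn (t₁.bdEqual t₂)
  | rel {n k : ℕ} (R : L.Relations k) (ts : Fin k → L.Term (α ⊕ Fin n)) :
      IsHorn (R.boundedFormula ts)
  | inf {n : ℕ} {φ ψ : L.BoundedFormula α n} : IsHorn φ → IsHorn ψ → IsHorn (φ ⊓ ψ)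

/-- Coherent formulas: built from atomic formulas, `⊤` and `⊥` by `∧`, `∨` and `∃`. -/
inductive IsCoherent {α : Type*} : ∀ {n : ℕ}, L.BoundedFormula α n → Prop
  | falsum {n : ℕ} : IsCoherent (⊥ : L.BoundedFormula α n)
  | top {n : ℕ} : IsCoherent (⊤ : L.BoundedFormula α n)
  | equal {n : ℕ} (t₁ t₂ : L.Term (α ⊕ Fin n)) : IsCoherent (t₁.bdEqual t₂)
  | rel {n k : ℕ} (R : L.Relations k) (ts : Fin k → L.Term (α ⊕ Fin n)) :
      IsCoherent (R.boundedFormula ts)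
  | inf {n : ℕ} {φ ψ : L.BoundedFormula α n} : IsCoherent φ → IsCoherent ψ → IsCoherent (φ ⊓ ψ)
  | sup {n : ℕ} {φ ψ : L.BoundedFormula α n} : IsCoherent φ → IsCoherent ψ → IsCoherent (φ ⊔ ψ)
  | ex {n : ℕ} {φ : L.BoundedFormula α (n + 1)} : IsCoherent φ → IsCoherent φ.ex

/-- A coherent sequent: a sentence of the form `∀ x₁ … xₙ (φ → ψ)` with `φ, ψ` coherent. -/
def IsCoherentSequent (σ : L.Sentence) : Prop :=
  ∃ (n : ℕ) (φ ψ : L.BoundedFormula Empty n),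
    IsCoherent φ ∧ IsCoherent ψ ∧ σ = (φ.imp ψ).alls


variable (L S)

/-- The sheaf `D_φ` of realizations of `φ` over the space of `S`-indexed models of `T`. -/
structure DSet (T : Set L.Sentence) {n : ℕ} (φ : L.Formula (Fin n)) where
  str : IndexedStructure L S
  mods : str.models T
  tup : Fin n → str.carrier
  sat : str.Sat φ tup

variable {L S}

/-- The projection `π₁ : D_φ → M_T`. -/
def DSet.pi {T : Set L.Sentence} {n : ℕ} {φ : L.Formula (Fin n)} (d : DSet L S T φ) :
    ModelsT L S T := ⟨d.str, d.mods⟩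

variable (L S)

/-- The image of the section `s_a : ⟨φ,a⟩ ∩ M_T → D_φ`. -/
def secImage (T : Set L.Sentence) {n : ℕ} (φ : L.Formula (Fin n)) (a : Fin n → S) :
    Set (DSet L S T φ) :=
  {d | ∃ h : ∀ i, a i ∈ d.str.A, d.tup = fun i => d.str.cls (a i) (h i)}

/-- The logical topology on `D_φ`: the coarsest topology making `π₁` continuous and making the
image of every section `s_a` open. -/
def dTopology (T : Set L.Sentence) {n : ℕ} (φ : L.Formula (Fin n)) :
    TopologicalSpace (DSet L S T φ) :=
  (TopologicalSpace.induced DSet.pi inferInstance) ⊓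
    generateFrom {V | ∃ a : Fin n → S, V = secImage L S T φ a}

instance {T : Set L.Sentence} {n : ℕ} {φ : L.Formula (Fin n)} :
    TopologicalSpace (DSet L S T φ) := dTopology L S T φ

/-- The basic open set `⟨ψ, b⟩` of `D_φ`. -/
def dBasic (T : Set L.Sentence) {n : ℕ} (φ : L.Formula (Fin n)) {m : ℕ}
    (ψ : L.Formula (Fin n ⊕ Fin m)) (b : Fin m → S) : Set (DSet L S T φ) :=
  {d | ∃ h : ∀ j, b j ∈ d.str.A,
    d.str.Sat ψ (Sum.elim d.tup fun j => d.str.cls (b j) (h j))}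

/-- The fiber product `I_T ×_{M_T} D_φ` of composable pairs for the application action. -/
def ActPairs (T : Set L.Sentence) {n : ℕ} (φ : L.Formula (Fin n)) :=
  {p : IsoT L S T × DSet L S T φ // p.1.1.dom = p.2.str}

instance {T : Set L.Sentence} {n : ℕ} {φ : L.Formula (Fin n)} :
    TopologicalSpace (ActPairs L S T φ) := instTopologicalSpaceSubtype

variable {L S}

/-- Isomorphisms of indexed structures preserve satisfaction. -/
theorem IndexedIso.sat_map (F : IndexedIso L S) {α : Type*} (φ : L.Formula α)
    (v : α → F.dom.carrier) (h : F.dom.Sat φ v) :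
    F.cod.Sat φ fun i => F.map (v i) := by
  letI := F.dom.str
  letI := F.cod.str
  have := (StrongHomClass.realize_formula (F.iso) φ (v := v)).mpr h
  exact this

/-- Transport of satisfaction along an equality of indexed structures. -/
theorem sat_cast {M N : IndexedStructure L S} (h : M = N) {α : Type*} (φ : L.Formula α)
    (v : α → N.carrier) (hs : N.Sat φ v) :
    M.Sat φ fun i => cast (congrArg IndexedStructure.carrier h.symm) (v i) := by
  subst h; exact hs

/-- The application action `θ : I_T ×_{M_T} D_φ → D_φ`. -/
def act {T : Set L.Sentence} {n : ℕ} {φ : L.Formula (Fin n)} (p : ActPairs L S T φ) :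
    DSet L S T φ where
  str := p.1.1.1.cod
  mods := p.1.1.2.2
  tup := fun i =>
    p.1.1.1.map (cast (congrArg IndexedStructure.carrier p.2.symm) (p.1.2.tup i))
  sat := p.1.1.1.sat_map φ _ (sat_cast p.2 φ p.1.2.tup p.1.2.sat)

/-- A subset of `D_φ` is stable if it is closed under the application action. -/
def Stable {T : Set L.Sentence} {n : ℕ} {φ : L.Formula (Fin n)}
    (X : Set (DSet L S T φ)) : Prop :=
  ∀ p : ActPairs L S T φ, p.1.2 ∈ X → act p ∈ X

/-- The stabilization of a subset of `D_φ`: the smallest stable subset containing it. -/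
def stabilization {T : Set L.Sentence} {n : ℕ} {φ : L.Formula (Fin n)}
    (X : Set (DSet L S T φ)) : Set (DSet L S T φ) :=
  ⋂₀ {Y | X ⊆ Y ∧ Stable Y}

/-- The set `{(M,m) ∈ D_φ : M ⊨ ∃y ψ(m,y)}`. -/
def exSet {T : Set L.Sentence} {n : ℕ} (φ : L.Formula (Fin n)) {m : ℕ}
    (ψ : L.Formula (Fin n ⊕ Fin m)) : Set (DSet L S T φ) :=
  {d | ∃ w : Fin m → d.str.carrier, d.str.Sat ψ (Sum.elim d.tup w)}

/-- The identity isomorphism on a model of `T`, as an element of `I_T`. -/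
def idIsoT {T : Set L.Sentence} (M : ModelsT L S T) : IsoT L S T :=
  ⟨idIso M.1, M.2, M.2⟩

/-- The inverse, in `I_T`. -/
def IsoT.inv {T : Set L.Sentence} (F : IsoT L S T) : IsoT L S T :=
  ⟨F.1.inv, F.2.2, F.2.1⟩

/-- The composite, in `I_T`. -/
def IsoT.comp {T : Set L.Sentence} (F G : IsoT L S T) (h : F.1.cod = G.1.dom) : IsoT L S T :=
  ⟨F.1.comp G.1 h, F.2.1, G.2.2⟩



variable {L : FirstOrder.Language.{u, v}} {S : Type w}

/-- A map into the space of isomorphisms is continuous as soon as its composites with the domain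
and codomain maps are, and the preimages of the sets `⟨a ↦ b⟩` are open. -/
theorem continuous_indexedIso {X : Type*} [TopologicalSpace X] {f : X → IndexedIso L S}
    (hd : Continuous fun x => (f x).dom) (hc : Continuous fun x => (f x).cod)
    (hm : ∀ a b : S, IsOpen (f ⁻¹' mapSet a b)) : Continuous f := by
  refine continuous_inf_rng.2 ⟨continuous_inf_rng.2
    ⟨continuous_induced_rng.2 hd, continuous_induced_rng.2 hc⟩, continuous_generateFrom_iff.2 ?_⟩
  rintro _ ⟨a, b, rfl⟩
  exact hm a b

theorem IndexedIso.continuous_dom :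
    Continuous (IndexedIso.dom : IndexedIso L S → IndexedStructure L S) :=
  continuous_iff_le_induced.2 (inf_le_left.trans inf_le_left :
    isoTopology L S ≤ (logicalTopology L S).induced IndexedIso.dom)

theorem IndexedIso.continuous_cod :
    Continuous (IndexedIso.cod : IndexedIso L S → IndexedStructure L S) :=
  continuous_iff_le_induced.2 (inf_le_left.trans inf_le_right :
    isoTopology L S ≤ (logicalTopology L S).induced IndexedIso.cod)

theorem isOpen_mapSet (a b : S) : IsOpen (mapSet a b : Set (IndexedIso L S)) := by
  have h : generateFrom {V | ∃ a b : S, V = mapSet a b} ≥ isoTopology L S := inf_le_right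
  exact h _ (isOpen_generateFrom_of_mem ⟨a, b, rfl⟩)

/-- The structures in which `a` and `b` are indexed and name the same element form an open set. -/
theorem isOpen_setOf_cls_eq (a b : S) :
    IsOpen {M : IndexedStructure L S | ∃ (ha : a ∈ M.A) (hb : b ∈ M.A),
      M.cls a ha = M.cls b hb} := by
  refine isOpen_generateFrom_of_mem (Or.inr ⟨2, Term.equal (Term.var 0) (Term.var 1),
    .equal _ _, ![a, b], ?_⟩)
  ext M
  let _ := M.str
  constructor
  · rintro ⟨ha, hb, h⟩
    refine ⟨Fin.forall_fin_two.2 ⟨ha, hb⟩, ?_⟩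
    exact Formula.realize_equal.2 h
  · rintro ⟨h, hs⟩
    exact ⟨h 0, h 1, Formula.realize_equal.1 hs⟩

theorem idIso_preimage_mapSet (a b : S) :
    (idIso : IndexedStructure L S → IndexedIso L S) ⁻¹' mapSet a b =
      {M | ∃ (ha : a ∈ M.A) (hb : b ∈ M.A), M.cls a ha = M.cls b hb} :=
  rfl

theorem IndexedIso.inv_preimage_mapSet (a b : S) :
    (IndexedIso.inv : IndexedIso L S → IndexedIso L S) ⁻¹' mapSet a b = mapSet b a := by
  ext F
  let _ := F.dom.str
  let _ := F.cod.str
  constructor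
  · rintro ⟨ha, hb, h⟩
    exact ⟨hb, ha, (F.iso.toEquiv.symm_apply_eq.1 h).symm⟩
  · rintro ⟨hb, ha, h⟩
    exact ⟨ha, hb, F.iso.toEquiv.symm_apply_eq.2 h.symm⟩

theorem IndexedIso.comp_mem_mapSet_iff (F G : IndexedIso L S) (h : F.cod = G.dom) (a c : S) :
    F.comp G h ∈ mapSet a c ↔ ∃ b, F ∈ mapSet a b ∧ G ∈ mapSet b c := by
  obtain ⟨M, N, f⟩ := F
  obtain ⟨N', K, g⟩ := G
  obtain rfl : N = N' := h
  let _ := M.str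
  let _ := N.str
  let _ := K.str
  constructor
  · rintro ⟨ha, hc, hac⟩
    obtain ⟨⟨b, hb⟩, hfb⟩ := Quotient.exists_rep (f.toEquiv (M.cls a ha))
    refine ⟨b, ⟨ha, hb, hfb.symm⟩, hb, hc, ?_⟩
    exact (congrArg g.toEquiv hfb).trans hac
  · rintro ⟨b, ⟨ha, _, hab⟩, _, hc, hbc⟩
    exact ⟨ha, hc, (congrArg g.toEquiv hab).trans hbc⟩

theorem stmt4 :
    Continuous (idIso : IndexedStructure L S → IndexedIso L S) ∧
    Continuous (IndexedIso.inv : IndexedIso L S → IndexedIso L S) ∧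
    Continuous (fun p : CompPairs L S => p.1.1.comp p.1.2 p.2) := by
  refine ⟨?_, ?_, ?_⟩
  · refine continuous_indexedIso continuous_id continuous_id fun a b => ?_
    rw [idIso_preimage_mapSet]
    exact isOpen_setOf_cls_eq a b
  · refine continuous_indexedIso IndexedIso.continuous_cod IndexedIso.continuous_dom fun a b => ?_
    rw [IndexedIso.inv_preimage_mapSet]
    exact isOpen_mapSet b a
  · have h₁ : Continuous fun p : CompPairs L S => p.1.1 :=
      continuous_fst.comp continuous_subtype_val
    have h₂ : Continuous fun p : CompPairs L S => p.1.2 :=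
      continuous_snd.comp continuous_subtype_val
    have hd : Continuous fun p : CompPairs L S => p.1.1.dom := IndexedIso.continuous_dom.comp h₁
    have hc : Continuous fun p : CompPairs L S => p.1.2.cod := IndexedIso.continuous_cod.comp h₂
    refine continuous_indexedIso hd hc fun a c => ?_
    simp only [preimage, IndexedIso.comp_mem_mapSet_iff, ofPred_exists]
    exact isOpen_iUnion fun b =>
      ((isOpen_mapSet a b).preimage h₁).inter ((isOpen_mapSet b c).preimage h₂)

end SemGpd
end

section
/- Let T be a set of coherent sequents, i.e. L-sentences of the form ∀x₁…∀xₙ(φ → ψ) with φ, ψ coherent formulas with free variables among x₁,…,xₙ. Then the space M_T of S-indexed models of T, with the subspace logical topology, is a sober topological space (every irreducible closed subset has a unique generic point; equivalently, every completely prime filter of open sets is the neighborhood filter of a unique point). -/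
open FirstOrder Language Set Topology TopologicalSpace Cardinal

universe u v w

namespace SemGpd

variable (L : FirstOrder.Language.{u, v}) (S : Type w)

variable {L S}

variable (L S)

variable {L S}

variable (L S)

variable {L S}

variable (L S)

variable {L S}

variable (L S)

variable {L S}

variable (L S)

variable {L S}

variable {L : FirstOrder.Language.{u, v}} {S : Type w}

theorem IndexedStructure.exists_cls (M : IndexedStructure L S) (x : M.carrier) :
    ∃ (a : S) (h : a ∈ M.A), M.cls a h = x := by
  obtain ⟨⟨a, h⟩, rfl⟩ := Quotient.exists_rep x
  exact ⟨a, h, rfl⟩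

theorem IndexedStructure.exists_cls_tuple {ι : Type*} (M : IndexedStructure L S)
    (x : ι → M.carrier) :
    ∃ (a : ι → S) (h : ∀ i, a i ∈ M.A), (fun i => M.cls (a i) (h i)) = x := by
  choose a h e using fun i => M.exists_cls (x i)
  exact ⟨a, h, funext e⟩

/-- The structures in which `a` and `b` index the same element. -/
def eqSet (a b : S) : Set (IndexedStructure L S) :=
  {M | ∃ (ha : a ∈ M.A) (hb : b ∈ M.A), M.cls a ha = M.cls b hb}

/-- The structures in which `f(a) = b`. -/
def funSet {k : ℕ} (f : L.Functions k) (a : Fin k → S) (b : S) : Set (IndexedStructure L S) :=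
  {M | ∃ (ha : ∀ i, a i ∈ M.A) (hb : b ∈ M.A),
    M.str.funMap f (fun i => M.cls (a i) (ha i)) = M.cls b hb}

/-- The structures in which `R(a)` holds. -/
def relSet {k : ℕ} (R : L.Relations k) (a : Fin k → S) : Set (IndexedStructure L S) :=
  {M | ∃ ha : ∀ i, a i ∈ M.A, M.str.RelMap R fun i => M.cls (a i) (ha i)}

/-- The structures in which the term `t` takes the value `b` at `v`. -/
def termSet {β : Type*} (t : L.Term β) (v : β → S) (b : S) : Set (IndexedStructure L S) :=
  {M | ∃ (hv : ∀ i, v i ∈ M.A) (hb : b ∈ M.A),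
    letI := M.str
    t.realize (fun i => M.cls (v i) (hv i)) = M.cls b hb}

/-- The structures in which the bounded formula `φ` holds at `v`. -/
def formulaSet {α : Type*} {n : ℕ} (φ : L.BoundedFormula α n) (v : α ⊕ Fin n → S) :
    Set (IndexedStructure L S) :=
  {M | ∃ hv : ∀ i, v i ∈ M.A,
    letI := M.str
    φ.Realize (fun i => M.cls (v (Sum.inl i)) (hv _)) fun j => M.cls (v (Sum.inr j)) (hv _)}

theorem mem_formulaSet_empty {M : IndexedStructure L S} {n : ℕ} {φ : L.BoundedFormula Empty n}
    {a : Fin n → S} :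
    M ∈ formulaSet φ (Sum.elim Empty.elim a) ↔ ∃ ha : ∀ i, a i ∈ M.A,
      letI := M.str
      φ.Realize (default : Empty → M.carrier) fun i => M.cls (a i) (ha i) := by
  constructor
  · rintro ⟨hv, h⟩
    refine ⟨fun i => hv (Sum.inr i), ?_⟩
    rw [Subsingleton.elim (fun i : Empty => M.cls _ _) default] at h
    exact h
  · rintro ⟨ha, h⟩
    refine ⟨Sum.rec (fun i => i.elim) ha, ?_⟩
    rw [Subsingleton.elim (fun i : Empty => M.cls _ _) default]
    exact h

/-- A predicate on sets of indexed structures that holds for the sets defining the logical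
topology and is stable under finite intersections and unions. -/
structure IsGeometric (P : Set (IndexedStructure L S) → Prop) : Prop where
  memb (a : S) : P (membSet L S a)
  eq (a b : S) : P (eqSet a b)
  func {k : ℕ} (f : L.Functions k) (a : Fin k → S) (b : S) : P (funSet f a b)
  rel {k : ℕ} (R : L.Relations k) (a : Fin k → S) : P (relSet R a)
  univ : P univ
  inter {U V : Set (IndexedStructure L S)} : P U → P V → P (U ∩ V)
  iUnion {ι : Type w} {U : ι → Set (IndexedStructure L S)} : (∀ i, P (U i)) → P (⋃ i, U i)

namespace IsGeometric

variable {P : Set (IndexedStructure L S) → Prop}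

theorem iInter (hP : IsGeometric P) {ι : Type*} [Finite ι] {U : ι → Set (IndexedStructure L S)}
    (hU : ∀ i, P (U i)) : P (⋂ i, U i) := by
  classical
  cases nonempty_fintype ι
  suffices h : ∀ s : Finset ι, P (⋂ i ∈ s, U i) by simpa using h Finset.univ
  intro s
  induction s using Finset.induction_on with
  | empty => simpa using hP.univ
  | insert a s _ ih => simpa using hP.inter (hU a) ih

theorem membs (hP : IsGeometric P) {β : Type*} [Finite β] (v : β → S) :
    P {M | ∀ i, v i ∈ M.A} := by
  have : {M : IndexedStructure L S | ∀ i, v i ∈ M.A} = ⋂ i, membSet L S (v i) := by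
    ext M
    simp [membSet]
  rw [this]
  exact hP.iInter fun i => hP.memb _

theorem termSet (hP : IsGeometric P) {β : Type*} [Finite β] (t : L.Term β) (v : β → S) (b : S) :
    P (termSet t v b) := by
  induction t generalizing b with
  | var i =>
    have : SemGpd.termSet (L := L) (Term.var i) v b =
        {M | ∀ i, v i ∈ M.A} ∩ eqSet (v i) b := by
      ext M
      constructor
      · rintro ⟨hv, hb, h⟩
        exact ⟨hv, hv i, hb, h⟩
      · rintro ⟨hv, _, hb, h⟩
        exact ⟨hv, hb, h⟩
    rw [this]
    exact hP.inter (hP.membs v) (hP.eq _ _)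
  | func f ts ih =>
    have : SemGpd.termSet (Term.func f ts) v b = {M | ∀ i, v i ∈ M.A} ∩
        ⋃ c, (⋂ i, SemGpd.termSet (ts i) v (c i)) ∩ funSet f c b := by
      ext M
      let := M.str
      simp only [mem_inter_iff, mem_iUnion, mem_iInter]
      constructor
      · rintro ⟨hv, hb, h⟩
        obtain ⟨c, hc, e⟩ := M.exists_cls_tuple
          fun i => (ts i).realize fun i => M.cls (v i) (hv i)
        refine ⟨hv, c, fun i => ⟨hv, hc i, (congrFun e i).symm⟩, hc, hb, ?_⟩
        rw [e]
        exact h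
      · rintro ⟨hv, c, h, hc, hb, e⟩
        refine ⟨hv, hb, ?_⟩
        rw [← e]
        change Structure.funMap f _ = _
        congr 1
        funext i
        exact (h i).2.2
    rw [this]
    exact hP.inter (hP.membs v)
      (hP.iUnion fun c => hP.inter (hP.iInter fun i => ih i _) (hP.func f c b))

theorem realize_term_sumElim (M : IndexedStructure L S) {α : Type*} {n : ℕ}
    (v : α ⊕ Fin n → S) (hv : ∀ i, v i ∈ M.A) :
    Sum.elim (fun i => M.cls (v (Sum.inl i)) (hv _)) (fun j => M.cls (v (Sum.inr j)) (hv _)) =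
      fun i => M.cls (v i) (hv i) := by
  funext i
  cases i <;> rfl

theorem formulaSet (hP : IsGeometric P) {α : Type*} [Finite α] {n : ℕ}
    {φ : L.BoundedFormula α n} (hφ : IsCoherent φ) (v : α ⊕ Fin n → S) :
    P (formulaSet φ v) := by
  induction hφ with
  | falsum =>
    convert hP.iUnion (ι := PEmpty) (U := PEmpty.elim) (fun i => i.elim)
    ext M
    simp only [mem_iUnion, IsEmpty.exists_iff, iff_false]
    rintro ⟨_, h⟩
    exact h
  | top =>
    convert hP.membs v using 1
    ext M
    let := M.str
    exact ⟨fun h => h.1, fun h => ⟨h, BoundedFormula.realize_top.2 trivial⟩⟩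
  | equal t₁ t₂ =>
    convert hP.iUnion fun b : S => hP.inter (hP.termSet t₁ v b) (hP.termSet t₂ v b)
    ext M
    let := M.str
    simp only [mem_iUnion]
    constructor
    · rintro ⟨hv, h⟩
      rw [BoundedFormula.realize_bdEqual, realize_term_sumElim M v hv] at h
      obtain ⟨b, hb, e⟩ := M.exists_cls (t₁.realize fun i => M.cls (v i) (hv i))
      exact ⟨b, ⟨hv, hb, e.symm⟩, hv, hb, h.symm.trans e.symm⟩
    · rintro ⟨b, ⟨hv, hb, h₁⟩, _, _, h₂⟩
      refine ⟨hv, ?_⟩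
      rw [BoundedFormula.realize_bdEqual, realize_term_sumElim M v hv]
      exact h₁.trans h₂.symm
  | rel R ts =>
    convert hP.inter (hP.membs v) <| hP.iUnion fun c : Fin _ → S =>
      hP.inter (hP.iInter fun i => hP.termSet (ts i) v (c i)) (hP.rel R c)
    ext M
    let := M.str
    simp only [mem_inter_iff, mem_iUnion, mem_iInter]
    constructor
    · rintro ⟨hv, h⟩
      rw [BoundedFormula.realize_rel, realize_term_sumElim M v hv] at h
      obtain ⟨c, hc, e⟩ := M.exists_cls_tuple
        fun i => (ts i).realize fun i => M.cls (v i) (hv i)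
      refine ⟨hv, c, fun i => ⟨hv, hc i, (congrFun e i).symm⟩, hc, ?_⟩
      rw [e]
      exact h
    · rintro ⟨hv, c, h, hc, e⟩
      refine ⟨hv, ?_⟩
      rw [BoundedFormula.realize_rel, realize_term_sumElim M v hv]
      convert e with i
      exact (h i).2.2
  | inf _ _ ih₁ ih₂ =>
    convert hP.inter (ih₁ v) (ih₂ v)
    ext M
    let := M.str
    constructor
    · rintro ⟨hv, h⟩
      rw [BoundedFormula.realize_inf] at h
      exact ⟨⟨hv, h.1⟩, hv, h.2⟩
    · rintro ⟨⟨hv, h₁⟩, _, h₂⟩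
      exact ⟨hv, BoundedFormula.realize_inf.2 ⟨h₁, h₂⟩⟩
  | @sup _ φ ψ _ _ ih₁ ih₂ =>
    convert hP.iUnion (ι := ULift Bool)
      (U := fun i => bif i.down then SemGpd.formulaSet φ v else SemGpd.formulaSet ψ v)
      (by rintro ⟨_ | _⟩; exacts [ih₂ v, ih₁ v])
    ext M
    let := M.str
    simp only [mem_iUnion, ULift.exists, Bool.exists_bool, cond_true, cond_false]
    constructor
    · rintro ⟨hv, h⟩
      rw [BoundedFormula.realize_sup] at h
      exact h.symm.imp (fun h => ⟨hv, h⟩) fun h => ⟨hv, h⟩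
    · rintro (⟨hv, h⟩ | ⟨hv, h⟩)
      · exact ⟨hv, BoundedFormula.realize_sup.2 (Or.inr h)⟩
      · exact ⟨hv, BoundedFormula.realize_sup.2 (Or.inl h)⟩
  | @ex n φ _ ih =>
    convert hP.iUnion fun b : S =>
      ih (Sum.elim (fun i => v (Sum.inl i)) (Fin.snoc (fun j => v (Sum.inr j)) b))
    ext M
    let := M.str
    have snoc_cls (b : S) (hv : ∀ i, v i ∈ M.A) (hb : b ∈ M.A)
        (h : ∀ j, Fin.snoc (α := fun _ => S) (fun j => v (Sum.inr j)) b j ∈ M.A) :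
        (fun j => M.cls _ (h j)) = Fin.snoc (α := fun _ => M.carrier)
          (fun j => M.cls (v (Sum.inr j)) (hv _)) (M.cls b hb) := by
      funext j
      refine Fin.lastCases ?_ (fun j => ?_) j <;> simp
    simp only [mem_iUnion]
    constructor
    · rintro ⟨hv, h⟩
      rw [BoundedFormula.realize_ex] at h
      obtain ⟨x, h⟩ := h
      obtain ⟨b, hb, rfl⟩ := M.exists_cls x
      have hw : ∀ j, Fin.snoc (α := fun _ => S) (fun j => v (Sum.inr j)) b j ∈ M.A := fun j =>
        Fin.lastCases (by simpa using hb) (fun j => by simpa using hv (Sum.inr j)) j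
      refine ⟨b, Sum.rec (fun i => hv (Sum.inl i)) hw, ?_⟩
      rw [← snoc_cls b hv hb hw] at h
      exact h
    · rintro ⟨b, hw, h⟩
      have hb : b ∈ M.A := by simpa using hw (Sum.inr (Fin.last n))
      have hv : ∀ i, v i ∈ M.A := Sum.rec (fun i => hw (Sum.inl i))
        fun j => by simpa using hw (Sum.inr j.castSucc)
      refine ⟨hv, BoundedFormula.realize_ex.2 ⟨M.cls b hb, ?_⟩⟩
      rw [← snoc_cls b hv hb fun j => hw (Sum.inr j)]
      exact h

theorem fSet (hP : IsGeometric P) {n : ℕ} {φ : L.Formula (Fin n)}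
    (hφ : BoundedFormula.IsAtomic φ) (a : Fin n → S) : P (fSet L S φ a) := by
  have hc : IsCoherent φ := by
    cases hφ with
    | equal t₁ t₂ => exact .equal t₁ t₂
    | rel R ts => exact .rel R ts
  convert hP.formulaSet hc (Sum.elim a Fin.elim0)
  ext M
  let := M.str
  constructor
  · rintro ⟨h, hs⟩
    refine ⟨Sum.rec h fun j => j.elim0, ?_⟩
    rw [Subsingleton.elim (fun j : Fin 0 => M.cls _ _) default]
    exact hs
  · rintro ⟨h, hs⟩
    refine ⟨fun i => h (Sum.inl i), ?_⟩
    rw [Subsingleton.elim (fun j : Fin 0 => M.cls _ _) default] at hs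
    exact hs

end IsGeometric

theorem isOpen_membSet (a : S) : IsOpen (membSet L S a) :=
  isOpen_generateFrom_of_mem (Or.inl ⟨a, rfl⟩)

theorem isOpen_fSet {n : ℕ} {φ : L.Formula (Fin n)} (hφ : BoundedFormula.IsAtomic φ)
    (a : Fin n → S) : IsOpen (fSet L S φ a) :=
  isOpen_generateFrom_of_mem (Or.inr ⟨n, φ, hφ, a, rfl⟩)

theorem isOpen_eqSet (a b : S) : IsOpen (eqSet a b : Set (IndexedStructure L S)) := by
  convert isOpen_fSet (L := L) (φ := (Term.var (Sum.inl 0)).bdEqual (Term.var (Sum.inl 1)))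
    (.equal _ _) ![a, b]
  ext M
  constructor
  · rintro ⟨ha, hb, h⟩
    exact ⟨Fin.forall_fin_two.2 ⟨ha, hb⟩, h⟩
  · rintro ⟨h, hs⟩
    exact ⟨h 0, h 1, hs⟩

theorem isOpen_relSet {k : ℕ} (R : L.Relations k) (a : Fin k → S) : IsOpen (relSet R a) :=
  isOpen_fSet (φ := R.boundedFormula fun i => Term.var (Sum.inl i)) (.rel _ _) a

theorem isOpen_funSet {k : ℕ} (f : L.Functions k) (a : Fin k → S) (b : S) :
    IsOpen (funSet f a b) := by
  convert isOpen_fSet (L := L)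
    (φ := (Term.func f fun i : Fin k => Term.var (Sum.inl i.castSucc)).bdEqual
      (Term.var (Sum.inl (Fin.last k))))
    (.equal _ _) (Fin.snoc a b)
  ext M
  let := M.str
  constructor
  · rintro ⟨ha, hb, h⟩
    refine ⟨fun j => Fin.lastCases (by simpa using hb) (fun j => by simpa using ha j) j, ?_⟩
    change Structure.funMap f (fun i => M.cls _ _) = M.cls _ _
    simpa using h
  · rintro ⟨h, hs⟩
    refine ⟨fun i => by simpa using h i.castSucc, by simpa using h (Fin.last k), ?_⟩
    change Structure.funMap f (fun i => M.cls _ _) = M.cls _ _ at hs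
    simpa using hs

theorem IndexedStructure.eq_of_inseparable {M N : IndexedStructure L S}
    (h : Inseparable M N) : M = N := by
  have hmem (a : S) : M ∈ membSet L S a ↔ N ∈ membSet L S a :=
    h.mem_open_iff (isOpen_membSet a)
  have heq (a b : S) : M ∈ eqSet a b ↔ N ∈ eqSet a b := h.mem_open_iff (isOpen_eqSet a b)
  have hfun {k : ℕ} (f : L.Functions k) (a : Fin k → S) (b : S) :
      M ∈ funSet f a b ↔ N ∈ funSet f a b := h.mem_open_iff (isOpen_funSet f a b)
  have hrel {k : ℕ} (R : L.Relations k) (a : Fin k → S) :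
      M ∈ relSet R a ↔ N ∈ relSet R a := h.mem_open_iff (isOpen_relSet R a)
  clear h
  obtain ⟨A, r, str⟩ := M
  obtain ⟨A', r', str'⟩ := N
  obtain rfl : A = A' := Set.ext hmem
  obtain rfl : r = r' := by
    ext ⟨a, ha⟩ ⟨b, hb⟩
    have key (r : Setoid A) (str : L.Structure (Quotient r)) :
        (⟨A, r, str⟩ : IndexedStructure L S) ∈ eqSet a b ↔ r ⟨a, ha⟩ ⟨b, hb⟩ :=
      ⟨fun ⟨_, _, h⟩ => Quotient.exact h, fun h => ⟨ha, hb, Quotient.sound h⟩⟩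
    exact (key r str).symm.trans ((heq a b).trans (key r' str'))
  congr 1
  refine Structure.ext (funext fun k => funext fun f => funext fun x => ?_)
    (funext fun k => funext fun R => funext fun x => propext ?_)
  · obtain ⟨a, ha, rfl⟩ := exists_cls_tuple ⟨A, r, str⟩ x
    obtain ⟨b, hb, e⟩ := exists_cls ⟨A, r, str⟩
      (str.funMap f fun i => cls ⟨A, r, str⟩ (a i) (ha i))
    obtain ⟨_, _, h⟩ := (hfun f a b).1 ⟨ha, hb, e.symm⟩
    exact e.symm.trans h.symm
  · obtain ⟨a, ha, rfl⟩ := exists_cls_tuple ⟨A, r, str⟩ x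
    constructor
    · intro h
      exact ((hrel R a).1 ⟨ha, h⟩).2
    · intro h
      exact ((hrel R a).2 ⟨ha, h⟩).2

instance : T0Space (IndexedStructure L S) where
  t0 _ _ := IndexedStructure.eq_of_inseparable

/-- A filter is prime for `w`-small unions of open sets. -/
def IsOpenPrime {X : Type*} [TopologicalSpace X] (F : Filter X) : Prop :=
  ∀ ⦃ι : Type w⦄ (U : ι → Set X), (∀ i, IsOpen (U i)) → (⋃ i, U i) ∈ F → ∃ i, U i ∈ F

section Limit

variable {F : Filter (IndexedStructure L S)}

theorem funSet_mem_unique {k : ℕ} {f : L.Functions k} {a a' : Fin k → S} {b b' : S}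
    (h : funSet f a b ∈ F) (h' : funSet f a' b' ∈ F) (ha : ∀ i, eqSet (a i) (a' i) ∈ F) :
    eqSet b b' ∈ F := by
  filter_upwards [h, h', Filter.iInter_mem.2 ha] with M ⟨_, hb, e⟩ ⟨_, hb', e'⟩ hM
  refine ⟨hb, hb', ?_⟩
  rw [← e, ← e']
  congr 1
  funext i
  exact (mem_iInter.1 hM i).2.2

theorem funSet_mem_congr {k : ℕ} {f : L.Functions k} {a a' : Fin k → S} {b b' : S}
    (h : funSet f a b ∈ F) (ha : ∀ i, eqSet (a i) (a' i) ∈ F) (hb : eqSet b b' ∈ F) :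
    funSet f a' b' ∈ F := by
  filter_upwards [h, hb, Filter.iInter_mem.2 ha] with M ⟨_, _, e⟩ ⟨_, hb', e'⟩ hM
  rw [mem_iInter] at hM
  refine ⟨fun i => (hM i).2.1, hb', ?_⟩
  rw [← e', ← e]
  congr 1
  funext i
  exact (hM i).2.2.symm

theorem relSet_mem_congr {k : ℕ} {R : L.Relations k} {a a' : Fin k → S}
    (h : relSet R a ∈ F) (ha : ∀ i, eqSet (a i) (a' i) ∈ F) : relSet R a' ∈ F := by
  filter_upwards [h, Filter.iInter_mem.2 ha] with M ⟨_, e⟩ hM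
  rw [mem_iInter] at hM
  refine ⟨fun i => (hM i).2.1, ?_⟩
  convert e using 2 with i
  exact (hM i).2.2.symm

theorem eqSet_symm {a b : S} (h : eqSet a b ∈ F) : eqSet b a ∈ F := by
  filter_upwards [h] with M ⟨ha, hb, e⟩
  exact ⟨hb, ha, e.symm⟩

variable (F) in
/-- Two elements are identified when the filter says so. -/
def limitSetoid : Setoid {a : S | membSet L S a ∈ F} where
  r a b := eqSet (a : S) b ∈ F
  iseqv :=
    { refl := fun a => by
        filter_upwards [a.2] with M ha
        exact ⟨ha, ha, rfl⟩
      symm := eqSet_symm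
      trans := fun h h' => by
        filter_upwards [h, h'] with M ⟨ha, _, e⟩ ⟨_, hc, e'⟩
        exact ⟨ha, hc, e.trans e'⟩ }

theorem exists_funSet_mem (hF : IsOpenPrime.{w} F) {k : ℕ} (f : L.Functions k) (a : Fin k → S)
    (ha : ∀ i, membSet L S (a i) ∈ F) :
    ∃ b : {a : S | membSet L S a ∈ F}, funSet f a b ∈ F := by
  obtain ⟨b, hb⟩ := hF (fun b : S => funSet f a b) (isOpen_funSet f a) (by
    filter_upwards [Filter.iInter_mem.2 ha] with M hM
    obtain ⟨b, hb, e⟩ :=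
      M.exists_cls (M.str.funMap f fun i => M.cls (a i) (mem_iInter.1 hM i))
    exact mem_iUnion.2 ⟨b, fun i => mem_iInter.1 hM i, hb, e.symm⟩)
  refine ⟨⟨b, ?_⟩, hb⟩
  filter_upwards [hb] with M hM
  exact hM.2.1

/-- The indexed structure to which an open-prime filter converges. -/
noncomputable def limit (hF : IsOpenPrime.{w} F) : IndexedStructure L S where
  A := {a | membSet L S a ∈ F}
  r := limitSetoid F
  str :=
    { funMap := fun f x => Quotient.mk _
        (exists_funSet_mem hF f (fun i => (x i).out) fun i => (x i).out.2).choose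
      RelMap := fun R x => relSet R (fun i => ((x i).out : S)) ∈ F }

theorem eqSet_out_mem (a : {a : S | membSet L S a ∈ F}) :
    eqSet ((Quotient.mk (limitSetoid F) a).out : S) a ∈ F :=
  Quotient.mk_out (s := limitSetoid F) a

theorem limit_mem_eqSet (hF : IsOpenPrime.{w} F) (a b : S) :
    limit hF ∈ eqSet a b ↔ eqSet a b ∈ F := by
  constructor
  · rintro ⟨_, _, h⟩
    exact Quotient.exact h
  · intro h
    exact ⟨F.mem_of_superset h fun M hM => hM.1, F.mem_of_superset h fun M hM => hM.2.1,
      Quotient.sound h⟩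

theorem limit_mem_funSet (hF : IsOpenPrime.{w} F) {k : ℕ} (f : L.Functions k) (a : Fin k → S)
    (b : S) : limit hF ∈ funSet f a b ↔ funSet f a b ∈ F := by
  have spec (ha : ∀ i, membSet L S (a i) ∈ F) :=
    (exists_funSet_mem hF f
      (fun i => ((limit hF).cls (a i) (ha i)).out)
      fun i => ((limit hF).cls (a i) (ha i)).out.2).choose_spec
  constructor
  · rintro ⟨ha, _, h⟩
    exact funSet_mem_congr (spec ha) (fun i => eqSet_out_mem ⟨a i, ha i⟩) (Quotient.exact h)
  · intro h
    have ha : ∀ i, membSet L S (a i) ∈ F :=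
      fun i => F.mem_of_superset h fun M hM => hM.1 i
    exact ⟨ha, F.mem_of_superset h fun M hM => hM.2.1, Quotient.sound
      (funSet_mem_unique (spec ha) h fun i => eqSet_out_mem ⟨a i, ha i⟩)⟩

theorem limit_mem_relSet (hF : IsOpenPrime.{w} F) {k : ℕ} (R : L.Relations k) (a : Fin k → S) :
    limit hF ∈ relSet R a ↔ relSet R a ∈ F := by
  constructor
  · rintro ⟨ha, h⟩
    exact relSet_mem_congr h fun i => eqSet_out_mem ⟨a i, ha i⟩
  · intro h
    have ha : ∀ i, membSet L S (a i) ∈ F :=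
      fun i => F.mem_of_superset h fun M hM => hM.1 i
    exact ⟨ha, relSet_mem_congr h fun i => eqSet_symm (eqSet_out_mem ⟨a i, ha i⟩)⟩

theorem isGeometric_limit (hF : IsOpenPrime.{w} F) :
    IsGeometric fun U => IsOpen U ∧ (limit hF ∈ U ↔ U ∈ F) where
  memb a := ⟨isOpen_membSet a, Iff.rfl⟩
  eq a b := ⟨isOpen_eqSet a b, limit_mem_eqSet hF a b⟩
  func f a b := ⟨isOpen_funSet f a b, limit_mem_funSet hF f a b⟩
  rel R a := ⟨isOpen_relSet R a, limit_mem_relSet hF R a⟩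
  univ := ⟨isOpen_univ, by simp⟩
  inter hU hV := ⟨hU.1.inter hV.1, by rw [mem_inter_iff, Filter.inter_mem_iff, hU.2, hV.2]⟩
  iUnion {ι U} hU := by
    refine ⟨isOpen_iUnion fun i => (hU i).1, ?_⟩
    rw [mem_iUnion]
    constructor
    · rintro ⟨i, hi⟩
      exact F.mem_of_superset ((hU i).2.1 hi) (subset_iUnion U i)
    · intro h
      obtain ⟨i, hi⟩ := hF U (fun i => (hU i).1) h
      exact ⟨i, (hU i).2.2 hi⟩

theorem le_nhds_limit (hF : IsOpenPrime.{w} F) : F ≤ 𝓝 (limit hF) := by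
  refine le_of_le_of_eq ?_ nhds_generateFrom.symm
  refine le_iInf₂ fun U ⟨hM, hU⟩ => Filter.le_principal_iff.2 ?_
  obtain ⟨a, rfl⟩ | ⟨n, φ, hφ, a, rfl⟩ := hU
  · exact hM
  · exact ((isGeometric_limit hF).fSet hφ a).2.1 hM

theorem limit_specializes (hF : IsOpenPrime.{w} F) {N : IndexedStructure L S}
    (hN : ∀ U, IsOpen U → N ∈ U → U ∈ F) : limit hF ⤳ N := by
  refine specializes_iff_pure.2 (le_of_le_of_eq ?_ nhds_generateFrom.symm)
  refine le_iInf₂ fun U ⟨hNU, hU⟩ => Filter.le_principal_iff.2 ?_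
  replace hNU := hN U (isOpen_generateFrom_of_mem hU) hNU
  obtain ⟨a, rfl⟩ | ⟨n, φ, hφ, a, rfl⟩ := hU
  · exact hNU
  · exact ((isGeometric_limit hF).fSet hφ a).2.2 hNU

theorem limit_models (hF : IsOpenPrime.{w} F) {T : Set L.Sentence}
    (hT : ∀ σ ∈ T, IsCoherentSequent σ) (hFT : {M | M.models T} ∈ F) :
    (limit hF).models T := by
  intro σ hσ
  obtain ⟨n, φ, ψ, hφ, hψ, rfl⟩ := hT σ hσ
  let := (limit hF).str
  refine BoundedFormula.realize_alls.2 fun x => ?_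
  rw [BoundedFormula.realize_imp]
  intro h
  obtain ⟨a, ha, rfl⟩ := (limit hF).exists_cls_tuple x
  have hφF := ((isGeometric_limit hF).formulaSet hφ _).2.1 (mem_formulaSet_empty.2 ⟨ha, h⟩)
  have hψF : formulaSet ψ (Sum.elim Empty.elim a) ∈ F := by
    filter_upwards [hφF, hFT] with M hM hMT
    let := M.str
    obtain ⟨hv, hM⟩ := mem_formulaSet_empty.1 hM
    exact mem_formulaSet_empty.2 ⟨hv, BoundedFormula.realize_imp.1
      (BoundedFormula.realize_alls.1 (hMT _ hσ) fun j => M.cls (a j) (hv j)) hM⟩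
  exact (mem_formulaSet_empty.1 (((isGeometric_limit hF).formulaSet hψ _).2.2 hψF)).2

end Limit

/-- The filter generated by the open sets meeting an irreducible set. -/
def meetFilter {X : Type*} [TopologicalSpace X] {Z : Set X} (hZ : IsIrreducible Z) :
    Filter X where
  sets := {U | ∃ V ⊆ U, IsOpen V ∧ (Z ∩ V).Nonempty}
  univ_sets := ⟨univ, subset_rfl, isOpen_univ, by simpa using hZ.nonempty⟩
  sets_of_superset := fun ⟨V, hV, h⟩ hU => ⟨V, hV.trans hU, h⟩
  inter_sets := fun ⟨V, hV, hVo, hVZ⟩ ⟨W, hW, hWo, hWZ⟩ =>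
    ⟨V ∩ W, inter_subset_inter hV hW, hVo.inter hWo, hZ.isPreirreducible V W hVo hWo hVZ hWZ⟩

theorem mem_meetFilter {X : Type*} [TopologicalSpace X] {Z U : Set X} (hZ : IsIrreducible Z)
    (hU : IsOpen U) : U ∈ meetFilter hZ ↔ (Z ∩ U).Nonempty :=
  ⟨fun ⟨_, hV, _, h⟩ => h.mono (inter_subset_inter_right Z hV), fun h => ⟨U, subset_rfl, hU, h⟩⟩

theorem isOpenPrime_map_meetFilter {X Y : Type*} [TopologicalSpace X] [TopologicalSpace Y]
    {Z : Set X} (hZ : IsIrreducible Z) {f : X → Y} (hf : Continuous f) :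
    IsOpenPrime.{w} (Filter.map f (meetFilter hZ)) := by
  intro ι U hU h
  rw [Filter.mem_map, mem_meetFilter hZ ((isOpen_iUnion hU).preimage hf)] at h
  obtain ⟨x, hx, hxU⟩ := h
  obtain ⟨i, hi⟩ := mem_iUnion.1 hxU
  exact ⟨i, Filter.mem_map.2 ((mem_meetFilter hZ ((hU i).preimage hf)).2 ⟨x, hx, hi⟩)⟩

theorem stmt5 (T : Set L.Sentence) (hT : ∀ σ ∈ T, IsCoherentSequent σ) :
    QuasiSober (ModelsT L S T) ∧ T0Space (ModelsT L S T) := by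
  refine ⟨⟨fun {Z} hZ hZc => ?_⟩, inferInstance⟩
  have hF := isOpenPrime_map_meetFilter.{w} hZ
    (continuous_subtype_val (p := fun M : IndexedStructure L S => M.models T))
  have hM := limit_models hF hT (Filter.mem_map.2 (Filter.univ_mem' fun N => N.2))
  refine ⟨⟨limit hF, hM⟩, Subset.antisymm (hZc.closure_subset_iff.2 ?_) fun N hN => ?_⟩
  · rw [singleton_subset_iff]
    by_contra hmem
    have hU : Zᶜ ∈ meetFilter hZ :=
      Filter.map_le_iff_le_comap.1 (le_nhds_limit hF)
        ((nhds_induced Subtype.val (⟨limit hF, hM⟩ : ModelsT L S T)) ▸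
          hZc.isOpen_compl.mem_nhds hmem)
    obtain ⟨N, hN, hN'⟩ := (mem_meetFilter hZ hZc.isOpen_compl).1 hU
    exact hN' hN
  · refine specializes_iff_mem_closure.1 (IsInducing.subtypeVal.specializes_iff.1
      (limit_specializes hF fun U hU hNU => Filter.mem_map.2 ?_))
    exact (mem_meetFilter hZ (hU.preimage continuous_subtype_val)).2 ⟨N, hN, hNU⟩

end SemGpd
end
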